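/- (Conservation of the Hamiltonian H₂ along the KdV flow; instance of Proposition 3-15 (3).) Let u : ℝ × ℝ → ℝ be smooth (C^∞), 2π-periodic in its first variable (u(s+2π, t) = u(s,t) for all s,t), and satisfy the KdV equation ∂_t u + 6·u·∂_s u + ∂_s³ u = 0 everywhere. Then the quantity t ↦ ∫_0^{2π} ( u(s,t)³ − (1/2)·(∂_s u(s,t))² ) ds is constant in t. -/

import Mathlib

open scoped Real

/-- Partial derivative with respect to the first (space) variable. -/
noncomputable def pderivS (f : ℝ × ℝ → ℝ) : ℝ × ℝ → ℝ :=
  fun p => deriv (fun x => f (x, p.2)) p.1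

/-- Partial derivative with respect to the second (time) variable. -/
noncomputable def pderivT (f : ℝ × ℝ → ℝ) : ℝ × ℝ → ℝ :=
  fun p => deriv (fun y => f (p.1, y)) p.2

theorem pderivS_eq_fderiv {f : ℝ × ℝ → ℝ} {p : ℝ × ℝ} (hf : DifferentiableAt ℝ f p) :
    pderivS f p = fderiv ℝ f p (1, 0) :=
  (hf.hasFDerivAt.comp_hasDerivAt p.1
    ((hasDerivAt_id p.1).prodMk (hasDerivAt_const p.1 p.2))).deriv

theorem pderivT_eq_fderiv {f : ℝ × ℝ → ℝ} {p : ℝ × ℝ} (hf : DifferentiableAt ℝ f p) :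
    pderivT f p = fderiv ℝ f p (0, 1) :=
  (hf.hasFDerivAt.comp_hasDerivAt p.2
    ((hasDerivAt_const p.2 p.1).prodMk (hasDerivAt_id p.2))).deriv

theorem pderivS_eq_fderiv_fun {f : ℝ × ℝ → ℝ} (hf : ContDiff ℝ (⊤ : ℕ∞) f) :
    pderivS f = fun p => fderiv ℝ f p (1, 0) :=
  funext fun _ => pderivS_eq_fderiv (hf.differentiable (by simp)).differentiableAt

theorem pderivT_eq_fderiv_fun {f : ℝ × ℝ → ℝ} (hf : ContDiff ℝ (⊤ : ℕ∞) f) :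
    pderivT f = fun p => fderiv ℝ f p (0, 1) :=
  funext fun _ => pderivT_eq_fderiv (hf.differentiable (by simp)).differentiableAt

theorem ContDiff.pderivS {f : ℝ × ℝ → ℝ} (hf : ContDiff ℝ (⊤ : ℕ∞) f) :
    ContDiff ℝ (⊤ : ℕ∞) (pderivS f) := by
  rw [pderivS_eq_fderiv_fun hf]
  exact (hf.fderiv_right (by simp)).clm_apply contDiff_const

theorem ContDiff.pderivT {f : ℝ × ℝ → ℝ} (hf : ContDiff ℝ (⊤ : ℕ∞) f) :
    ContDiff ℝ (⊤ : ℕ∞) (pderivT f) := by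
  rw [pderivT_eq_fderiv_fun hf]
  exact (hf.fderiv_right (by simp)).clm_apply contDiff_const

/-- Mixed partial derivatives of a smooth function commute. -/
theorem pderivS_pderivT {f : ℝ × ℝ → ℝ} (hf : ContDiff ℝ (⊤ : ℕ∞) f) (p : ℝ × ℝ) :
    pderivS (pderivT f) p = pderivT (pderivS f) p := by
  have hd : DifferentiableAt ℝ (fderiv ℝ f) p :=
    ((hf.fderiv_right (m := 1) (by norm_cast)).differentiable (by simp)).differentiableAt
  have happ : ∀ v w : ℝ × ℝ,
      fderiv ℝ (fun q => fderiv ℝ f q v) p w = fderiv ℝ (fderiv ℝ f) p w v := fun v w => by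
    rw [fderiv_clm_apply hd (differentiableAt_const v)]
    simp
  rw [pderivS_eq_fderiv (hf.pderivT.differentiable (by simp)).differentiableAt,
    pderivT_eq_fderiv (hf.pderivS.differentiable (by simp)).differentiableAt,
    pderivS_eq_fderiv_fun hf, pderivT_eq_fderiv_fun hf, happ, happ]
  exact (hf.contDiffAt.isSymmSndFDerivAt (by simp; norm_cast)).eq _ _

theorem pderivS_add_period {f : ℝ × ℝ → ℝ} {c : ℝ} (h : ∀ s t : ℝ, f (s + c, t) = f (s, t))
    (s t : ℝ) : pderivS f (s + c, t) = pderivS f (s, t) := by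
  change deriv (fun x => f (x, t)) (s + c) = deriv (fun x => f (x, t)) s
  rw [← deriv_comp_add_const]
  simp only [h]

theorem pderivT_add_period {f : ℝ × ℝ → ℝ} {c : ℝ} (h : ∀ s t : ℝ, f (s + c, t) = f (s, t))
    (s t : ℝ) : pderivT f (s + c, t) = pderivT f (s, t) := by
  simp only [pderivT, h]

/-- A spatially periodic density satisfying a local conservation law with periodic flux has a
time-independent integral over a period. -/
theorem integral_eq_of_conservation_law {f g : ℝ × ℝ → ℝ} {c : ℝ}
    (hf : ContDiff ℝ (⊤ : ℕ∞) f) (hg : ContDiff ℝ (⊤ : ℕ∞) g)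
    (hper : ∀ t : ℝ, f (c, t) = f (0, t))
    (hdiv : ∀ p, fderiv ℝ f p (1, 0) + fderiv ℝ g p (0, 1) = 0) (t₁ t₂ : ℝ) :
    ∫ s in (0 : ℝ)..c, g (s, t₁) = ∫ s in (0 : ℝ)..c, g (s, t₂) := by
  have h := MeasureTheory.integral2_divergence_prod_of_hasFDerivAt f g (fderiv ℝ f) (fderiv ℝ g)
    0 t₁ c t₂ hf.continuous.continuousOn hg.continuous.continuousOn
    (fun p _ => (hf.differentiable (by simp)).differentiableAt.hasFDerivAt)
    (fun p _ => (hg.differentiable (by simp)).differentiableAt.hasFDerivAt)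
    (by simp only [hdiv]; exact MeasureTheory.integrableOn_zero)
  simp only [hdiv, hper, intervalIntegral.integral_zero] at h
  linarith

/-- Conservation of the Hamiltonian `H₂` along the KdV flow (Proposition 3-15 (3)):
for a smooth spatially `2π`-periodic solution of `∂_t u + 6u ∂_s u + ∂_s³ u = 0`,
the integral `∫₀^{2π} (u³ − ½(∂_s u)²) ds` is independent of `t`. -/
theorem kdv_conserves_H2 (u : ℝ × ℝ → ℝ)
    (hu : ContDiff ℝ (⊤ : ℕ∞) u)
    (hper : ∀ s t : ℝ, u (s + 2 * π, t) = u (s, t))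
    (hkdv : ∀ p : ℝ × ℝ,
      pderivT u p + 6 * u p * pderivS u p + pderivS (pderivS (pderivS u)) p = 0) :
    ∀ t₁ t₂ : ℝ,
      (∫ s in (0:ℝ)..(2 * π), (u (s, t₁) ^ 3 - (1 / 2) * (pderivS u (s, t₁)) ^ 2)) =
        ∫ s in (0:ℝ)..(2 * π), (u (s, t₂) ^ 3 - (1 / 2) * (pderivS u (s, t₂)) ^ 2) := by
  have ha := hu.pderivS
  have hb := ha.pderivS
  have hT := hu.pderivT
  have hper_a := pderivS_add_period hper
  have hper_b := pderivS_add_period hper_a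
  have hper_T := pderivT_add_period hper
  refine integral_eq_of_conservation_law
    (f := fun p => pderivS u p * pderivT u p
      + 1 / 2 * (3 * u p ^ 2 + pderivS (pderivS u) p) ^ 2)
    (g := fun p => u p ^ 3 - 1 / 2 * pderivS u p ^ 2)
    (by fun_prop) (by fun_prop) (fun t => ?_) (fun p => ?_)
  · rw [← zero_add (2 * π)]
    simp only [hper, hper_a, hper_b, hper_T]
  · have du : DifferentiableAt ℝ u p := (hu.differentiable (by simp)).differentiableAt
    have da : DifferentiableAt ℝ (pderivS u) p := (ha.differentiable (by simp)).differentiableAt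
    have db : DifferentiableAt ℝ (pderivS (pderivS u)) p :=
      (hb.differentiable (by simp)).differentiableAt
    have dT : DifferentiableAt ℝ (pderivT u) p := (hT.differentiable (by simp)).differentiableAt
    have hF := (da.hasFDerivAt.mul dT.hasFDerivAt).add
      (((((du.hasFDerivAt.pow 2).const_mul 3).add db.hasFDerivAt).pow 2).const_mul (1 / 2))
    have hG := (du.hasFDerivAt.pow 3).sub ((da.hasFDerivAt.pow 2).const_mul (1 / 2))
    refine (congrArg₂ (fun L M : ℝ × ℝ →L[ℝ] ℝ => L (1, 0) + M (0, 1))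
      hF.fderiv hG.fderiv).trans ?_
    simp [← pderivS_eq_fderiv, ← pderivT_eq_fderiv, du, da, db, dT]
    rw [pderivS_pderivT hu p]
    linear_combination (3 * u p ^ 2 + pderivS (pderivS u) p) * hkdv p
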